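/- Let A be a cocomplete symmetric monoidal abelian category such that: the tensor product is exact separately in each variable (for each object X, the functors X ⊗ (−) and (−) ⊗ X preserve finite limits and finite colimits); the tensor product preserves all small colimits separately in each variable; and filtered colimits in A are exact (commute with finite limits). Then for every ℤ-indexed cochain complex K in A and every quasi-isomorphism f : L → L' of ℤ-indexed cochain complexes in A, the induced morphism id_K ⊗ f : K ⊗ L → K ⊗ L' is a quasi-isomorphism; likewise f ⊗ id_K : L ⊗ K → L' ⊗ K is a quasi-isomorphism. -/

import Mathlib

open CategoryTheory Limits MonoidalCategory

namespace CategoryTheory.Limits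

lemma isoColimitCocone_hom_comp {C ι : Type*} [Category* C] [HasColimitsOfShape (Discrete ι) C]
    {X Y : ι → C} {A B : C} {a : ∀ i, X i ⟶ A} {b : ∀ i, Y i ⟶ B}
    (ha : IsColimit (Cofan.mk A a)) (hb : IsColimit (Cofan.mk B b))
    {f : ∀ i, X i ⟶ Y i} {g : A ⟶ B} (h : ∀ i, a i ≫ g = f i ≫ b i) :
    (colimit.isoColimitCocone ⟨_, ha⟩).hom ≫ g =
      colimMap (Discrete.natTrans (F := Discrete.functor X) (G := Discrete.functor Y)
        fun i ↦ f i.as) ≫ (colimit.isoColimitCocone ⟨_, hb⟩).hom :=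
  colimit.hom_ext fun ⟨i⟩ ↦ by
    rw [colimit.isoColimitCocone_ι_hom_assoc, ι_colimMap_assoc, colimit.isoColimitCocone_ι_hom]
    exact h i

end CategoryTheory.Limits

namespace CategoryTheory.ShortComplex

variable {C : Type*} [Category* C] [Abelian C]

/-- A morphism of short complexes in a functor category is a quasi-isomorphism if it is so
after evaluation at each object. -/
lemma quasiIso_of_evaluation {J : Type*} [Category* J] {S S' : ShortComplex (J ⥤ C)} (φ : S ⟶ S')
    (h : ∀ j, QuasiIso (((evaluation J C).obj j).mapShortComplex.map φ)) : QuasiIso φ := by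
  rw [quasiIso_iff, NatTrans.isIso_iff_isIso_app]
  intro j
  have := (quasiIso_iff _).1 (h j)
  have e : Arrow.mk (homologyMap (((evaluation J C).obj j).mapShortComplex.map φ)) ≅
      Arrow.mk ((homologyMap φ).app j) :=
    Arrow.isoMk (S.mapHomologyIso ((evaluation J C).obj j))
      (S'.mapHomologyIso ((evaluation J C).obj j))
      (mapHomologyIso_hom_naturality φ ((evaluation J C).obj j)).symm
  exact ((MorphismProperty.isomorphisms C).arrow_mk_iso_iff e).1 this

lemma exact_of_evaluation {J : Type*} [Category* J] {S : ShortComplex (J ⥤ C)}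
    (h : ∀ j, (S.map ((evaluation J C).obj j)).Exact) : S.Exact := by
  simp only [exact_iff_isZero_homology] at h ⊢
  refine (Functor.isZero_iff _).2 fun j ↦ ?_
  exact (h j).of_iso (S.mapHomologyIso ((evaluation J C).obj j)).symm

lemma shortExact_of_evaluation {J : Type*} [Category* J] {S : ShortComplex (J ⥤ C)}
    (h : ∀ j, (S.map ((evaluation J C).obj j)).ShortExact) : S.ShortExact where
  exact := exact_of_evaluation fun j ↦ (h j).exact
  mono_f := (NatTrans.mono_iff_mono_app _).2 fun j ↦ (h j).mono_f
  epi_g := (NatTrans.epi_iff_epi_app _).2 fun j ↦ (h j).epi_g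

variable {ι : Type*}

/-- The short complex of functors from a discrete category attached to a family of
short complexes. -/
def discreteFunctor (S : ι → ShortComplex C) : ShortComplex (Discrete ι ⥤ C) where
  X₁ := Discrete.functor fun i ↦ (S i).X₁
  X₂ := Discrete.functor fun i ↦ (S i).X₂
  X₃ := Discrete.functor fun i ↦ (S i).X₃
  f := Discrete.natTrans fun i ↦ (S i.as).f
  g := Discrete.natTrans fun i ↦ (S i.as).g
  zero := by
    ext i
    exact (S i.as).zero

/-- The morphism of `discreteFunctor`s induced by a family of morphisms. -/
def discreteFunctorMap {S S' : ι → ShortComplex C} (φ : ∀ i, S i ⟶ S' i) :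
    discreteFunctor S ⟶ discreteFunctor S' where
  τ₁ := Discrete.natTrans fun i ↦ (φ i.as).τ₁
  τ₂ := Discrete.natTrans fun i ↦ (φ i.as).τ₂
  τ₃ := Discrete.natTrans fun i ↦ (φ i.as).τ₃
  comm₁₂ := by ext i; exact (φ i.as).comm₁₂
  comm₂₃ := by ext i; exact (φ i.as).comm₂₃

/-- A family of morphisms of short complexes to `T` is termwise a coproduct. -/
structure IsTermwiseCoproduct {S : ι → ShortComplex C} {T : ShortComplex C}
    (inj : ∀ i, S i ⟶ T) where
  /-- The first terms form a coproduct. -/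
  isColimit₁ : IsColimit (Cofan.mk T.X₁ fun i ↦ (inj i).τ₁)
  /-- The second terms form a coproduct. -/
  isColimit₂ : IsColimit (Cofan.mk T.X₂ fun i ↦ (inj i).τ₂)
  /-- The third terms form a coproduct. -/
  isColimit₃ : IsColimit (Cofan.mk T.X₃ fun i ↦ (inj i).τ₃)

namespace IsTermwiseCoproduct

variable {S S' : ι → ShortComplex C} {T T' : ShortComplex C}
  {inj : ∀ i, S i ⟶ T} (h : IsTermwiseCoproduct inj)
  {inj' : ∀ i, S' i ⟶ T'} (h' : IsTermwiseCoproduct inj')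
  [HasColimitsOfShape (Discrete ι) C]

/-- A termwise coproduct of short complexes is obtained by applying the functor `colim`. -/
noncomputable def iso : (discreteFunctor S).map colim ≅ T :=
  isoMk (colimit.isoColimitCocone ⟨_, h.isColimit₁⟩) (colimit.isoColimitCocone ⟨_, h.isColimit₂⟩)
    (colimit.isoColimitCocone ⟨_, h.isColimit₃⟩)
    (isoColimitCocone_hom_comp _ _ fun i ↦ (inj i).comm₁₂)
    (isoColimitCocone_hom_comp _ _ fun i ↦ (inj i).comm₂₃)

variable [HasExactColimitsOfShape (Discrete ι) C]

include h in
lemma shortExact (hS : ∀ i, (S i).ShortExact) : T.ShortExact :=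
  shortExact_of_iso h.iso
    ((shortExact_of_evaluation (S := discreteFunctor S) fun i ↦ hS i.as).map_of_exact colim)

include h h' in
lemma quasiIso {φ : ∀ i, S i ⟶ S' i} {ψ : T ⟶ T'} (hψ : ∀ i, inj i ≫ ψ = φ i ≫ inj' i)
    (hφ : ∀ i, QuasiIso (φ i)) : QuasiIso ψ := by
  have : QuasiIso (discreteFunctorMap φ) := quasiIso_of_evaluation _ fun i ↦ hφ i.as
  have : QuasiIso ((colim (J := Discrete ι) (C := C)).mapShortComplex.map (discreteFunctorMap φ)) :=
    inferInstance
  refine (quasiIso_iff_of_arrow_mk_iso _ _ (Arrow.isoMk h.iso h'.iso ?_)).1 this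
  ext : 1
  · exact isoColimitCocone_hom_comp _ _ fun i ↦ congr_arg Hom.τ₁ (hψ i)
  · exact isoColimitCocone_hom_comp _ _ fun i ↦ congr_arg Hom.τ₂ (hψ i)
  · exact isoColimitCocone_hom_comp _ _ fun i ↦ congr_arg Hom.τ₃ (hψ i)

end IsTermwiseCoproduct

end CategoryTheory.ShortComplex

namespace HomologicalComplex

namespace HomologySequence

variable {C : Type*} [Category* C] [Abelian C] {S₁ S₂ : ShortComplex (CochainComplex C ℤ)}
  (φ : S₁ ⟶ S₂) (hS₁ : S₁.ShortExact) (hS₂ : S₂.ShortExact)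

include hS₁ hS₂

lemma quasiIso_τ₂ (h₁ : QuasiIso φ.τ₁) (h₃ : QuasiIso φ.τ₃) : QuasiIso φ.τ₂ := by
  rw [quasiIso_iff]
  intro i
  rw [quasiIsoAt_iff_isIso_homologyMap]
  have := Abelian.mono_of_epi_of_mono_of_mono
    ((ComposableArrows.δ₀Functor ⋙ ComposableArrows.δ₀Functor).map
      (mapComposableArrows₅ φ hS₁ hS₂ (i - 1) i (by simp)))
    (composableArrows₅_exact hS₁ _ _ _).δ₀.δ₀ (composableArrows₅_exact hS₂ _ _ _).δ₀.δ₀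
    (inferInstance : Epi (homologyMap φ.τ₃ (i - 1)))
    (inferInstance : Mono (homologyMap φ.τ₁ i))
    (inferInstance : Mono (homologyMap φ.τ₃ i))
  have := Abelian.epi_of_epi_of_epi_of_mono
    ((ComposableArrows.δlastFunctor ⋙ ComposableArrows.δlastFunctor).map
      (mapComposableArrows₅ φ hS₁ hS₂ i (i + 1) (by simp)))
    (composableArrows₅_exact hS₁ _ _ _).δlast.δlast
    (composableArrows₅_exact hS₂ _ _ _).δlast.δlast
    (inferInstance : Epi (homologyMap φ.τ₁ i))
    (inferInstance : Epi (homologyMap φ.τ₃ i))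
    (inferInstance : Mono (homologyMap φ.τ₁ (i + 1)))
  have : Mono (homologyMap φ.τ₂ i) := ‹_›
  have : Epi (homologyMap φ.τ₂ i) := ‹_›
  exact isIso_of_mono_of_epi _

end HomologySequence

section

variable {C ι : Type*} [Category* C] [Abelian C] {c : ComplexShape ι}
  (K : HomologicalComplex C c)

/-- The subcomplex of cycles, with zero differential. -/
noncomputable def cyclesComplex : HomologicalComplex C c where
  X i := K.cycles i
  d _ _ := 0

/-- The inclusion of the subcomplex of cycles. -/
noncomputable def cyclesComplexι : K.cyclesComplex ⟶ K where
  f i := K.iCycles i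
  comm' i j _ := (K.iCycles_d i j).trans zero_comp.symm

instance : Mono K.cyclesComplexι := mono_of_mono_f _ fun i ↦ inferInstanceAs (Mono (K.iCycles i))

/-- The short complex attached to the inclusion of the subcomplex of cycles. -/
noncomputable def cyclesShortComplex : ShortComplex (HomologicalComplex C c) where
  f := K.cyclesComplexι
  g := cokernel.π K.cyclesComplexι
  zero := cokernel.condition _

lemma cyclesShortComplex_shortExact : K.cyclesShortComplex.ShortExact where
  exact := ShortComplex.exact_of_g_is_cokernel _ (cokernelIsCokernel _)
  mono_f := inferInstanceAs (Mono K.cyclesComplexι)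
  epi_g := inferInstanceAs (Epi (cokernel.π K.cyclesComplexι))

lemma cokernel_cyclesComplexι_d (i j : ι) : (cokernel K.cyclesComplexι).d i j = 0 := by
  have : Epi ((cokernel.π K.cyclesComplexι).f i) := inferInstance
  have h : K.iCycles j ≫ (cokernel.π K.cyclesComplexι).f j = 0 :=
    congr_hom (cokernel.condition K.cyclesComplexι) j
  rw [← cancel_epi ((cokernel.π K.cyclesComplexι).f i), Hom.comm, ← K.toCycles_i, Category.assoc,
    h]
  simp

end

section

variable {C₁ C₂ D : Type*} [Category* C₁] [Category* C₂] [Category* D]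
  [Abelian C₁] [Abelian C₂] [Abelian D]

variable (F : C₁ ⥤ C₂ ⥤ D) [F.PreservesZeroMorphisms] [∀ X, (F.obj X).PreservesZeroMorphisms]

/-- The summands of `mapBifunctor K L F (.up ℤ)` in degree `n`, indexed by the degree in `K`
and with inclusions twisted by signs, form a coproduct. -/
noncomputable def mapBifunctorIsColimit (K : CochainComplex C₁ ℤ) (L : CochainComplex C₂ ℤ)
    [HasMapBifunctor K L F (.up ℤ)] (n : ℤ) (q : ℤ → ℤ) (hq : ∀ p, p + q p = n) (u : ℤ → ℤˣ) :
    IsColimit (Cofan.mk (f := fun p ↦ (F.obj (K.X p)).obj (L.X (q p)))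
      ((mapBifunctor K L F (.up ℤ)).X n)
      fun p ↦ u p • ιMapBifunctor K L F (.up ℤ) p (q p) n (hq p)) :=
  Cofan.IsColimit.mk _
    (fun s ↦ mapBifunctorDesc fun p q' (h : p + q' = n) ↦
      u p • ((F.obj (K.X p)).map (L.XIsoOfEq (by have := hq p; omega)).hom ≫ s.inj p))
    (fun s p ↦ by simp [Cofan.inj, smul_smul])
    (fun s m hm ↦ by
      refine mapBifunctor.hom_ext fun p q' h ↦ ?_
      obtain rfl : q' = q p := by have := hq p; change p + q' = n at h; omega
      rw [ι_mapBifunctorDesc, ← hm p]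
      simp [Cofan.inj, smul_smul])

lemma smul_ι_mapBifunctor_d_of_d_eq_zero (K : CochainComplex C₁ ℤ) (hK : ∀ i j, K.d i j = 0)
    (L : CochainComplex C₂ ℤ) [HasMapBifunctor K L F (.up ℤ)] {p q q' n n' : ℤ} (h : p + q = n)
    (h' : p + q' = n') (hq : q + 1 = q') {u v : ℤˣ} (huv : u * p.negOnePow = v) :
    (u • ιMapBifunctor K L F (.up ℤ) p q n h) ≫ (mapBifunctor K L F (.up ℤ)).d n n' =
      (F.obj (K.X p)).map (L.d q q') ≫ (v • ιMapBifunctor K L F (.up ℤ) p q' n' h') := by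
  rw [mapBifunctor.d_eq, Preadditive.comp_add, Linear.units_smul_comp, Linear.units_smul_comp,
    mapBifunctor.ι_D₁, mapBifunctor.ι_D₂, mapBifunctor.d₂_eq _ _ _ _ _ hq _ h',
    mapBifunctor.d₁_eq' _ _ _ _ rfl, hK, Functor.map_zero, zero_app, zero_comp, smul_zero,
    smul_zero, zero_add, smul_smul, Linear.comp_units_smul, ← huv]
  rfl

lemma smul_ι_mapBifunctorMap_id (K : CochainComplex C₁ ℤ) {L L' : CochainComplex C₂ ℤ} (f : L ⟶ L')
    [HasMapBifunctor K L F (.up ℤ)] [HasMapBifunctor K L' F (.up ℤ)] {p q n : ℤ} (h : p + q = n)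
    (u : ℤˣ) :
    (u • ιMapBifunctor K L F (.up ℤ) p q n h) ≫ (mapBifunctorMap (𝟙 K) f F (.up ℤ)).f n =
      (F.obj (K.X p)).map (f.f q) ≫ (u • ιMapBifunctor K L' F (.up ℤ) p q n h) := by
  simp

/-- If `K` has zero differential, the inclusion in the complex `mapBifunctor K L F (.up ℤ)`
of its direct summand given by the term of degree `p` in `K`. -/
noncomputable def toSc' (K : CochainComplex C₁ ℤ) (hK : ∀ i j, K.d i j = 0)
    (L : CochainComplex C₂ ℤ) [HasMapBifunctor K L F (.up ℤ)] (n p : ℤ) :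
    (L.sc' (n - 1 - p) (n - p) (n + 1 - p)).map (F.obj (K.X p)) ⟶
      (mapBifunctor K L F (.up ℤ)).sc' (n - 1) n (n + 1) where
  τ₁ := (1 : ℤˣ) • ιMapBifunctor K L F (.up ℤ) p (n - 1 - p) (n - 1) (add_sub_cancel _ _)
  τ₂ := p.negOnePow • ιMapBifunctor K L F (.up ℤ) p (n - p) n (add_sub_cancel _ _)
  τ₃ := (1 : ℤˣ) • ιMapBifunctor K L F (.up ℤ) p (n + 1 - p) (n + 1) (add_sub_cancel _ _)
  comm₁₂ := smul_ι_mapBifunctor_d_of_d_eq_zero F K hK L _ _ (by omega) (one_mul _)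
  comm₂₃ := smul_ι_mapBifunctor_d_of_d_eq_zero F K hK L _ _ (by omega) (Int.units_mul_self _)

/-- If `K` has zero differential, the complex `mapBifunctor K L F (.up ℤ)` is a coproduct
indexed by the degrees in `K`. -/
noncomputable def isTermwiseCoproductSc' (K : CochainComplex C₁ ℤ) (hK : ∀ i j, K.d i j = 0)
    (L : CochainComplex C₂ ℤ) [HasMapBifunctor K L F (.up ℤ)] (n : ℤ) :
    ShortComplex.IsTermwiseCoproduct (toSc' F K hK L n) where
  isColimit₁ := mapBifunctorIsColimit F K L (n - 1) _ _ _
  isColimit₂ := mapBifunctorIsColimit F K L n _ _ _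
  isColimit₃ := mapBifunctorIsColimit F K L (n + 1) _ _ _

variable [HasCoproducts.{0} D]

section

variable [AB4OfSize.{0} D]
  [∀ X, PreservesFiniteLimits (F.obj X)]
  [∀ X, PreservesFiniteColimits (F.obj X)]

lemma quasiIso_mapBifunctorMap_of_d_eq_zero (K : CochainComplex C₁ ℤ) (hK : ∀ i j, K.d i j = 0)
    {L L' : CochainComplex C₂ ℤ} (f : L ⟶ L') [QuasiIso f] :
    QuasiIso (mapBifunctorMap (𝟙 K) f F (.up ℤ)) := by
  rw [quasiIso_iff]
  intro n
  rw [quasiIsoAt_iff' _ (n - 1) n (n + 1) (by simp) (by simp)]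
  refine (isTermwiseCoproductSc' F K hK L n).quasiIso (isTermwiseCoproductSc' F K hK L' n)
    (φ := fun p ↦ (F.obj (K.X p)).mapShortComplex.map
      ((shortComplexFunctor' C₂ (.up ℤ) (n - 1 - p) (n - p) (n + 1 - p)).map f))
    (fun p ↦ ?_) (fun p ↦ ?_)
  · ext : 1 <;> exact smul_ι_mapBifunctorMap_id F K f _ _
  · have := (quasiIsoAt_iff' f (n - 1 - p) (n - p) (n + 1 - p) (by simp; omega)
      (by simp; omega)).1 inferInstance
    exact ShortComplex.quasiIso_map_of_preservesLeftHomology _ _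

end

variable [∀ Y, (F.flip.obj Y).PreservesZeroMorphisms]

/-- The short complex obtained by applying `mapBifunctor - L F (.up ℤ)`. -/
noncomputable def mapBifunctorShortComplex (S : ShortComplex (CochainComplex C₁ ℤ))
    (L : CochainComplex C₂ ℤ) : ShortComplex (CochainComplex D ℤ) where
  f := mapBifunctorMap S.f (𝟙 L) F (.up ℤ)
  g := mapBifunctorMap S.g (𝟙 L) F (.up ℤ)
  zero := by
    ext n : 1
    refine mapBifunctor.hom_ext fun p q h ↦ ?_
    rw [comp_f]
    have : F.map (S.f.f p) ≫ F.map (S.g.f p) = 0 := by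
      rw [← F.map_comp, ← comp_f, S.zero, zero_f, F.map_zero]
    simp [← NatTrans.comp_app_assoc, this]

/-- Functoriality of `mapBifunctorShortComplex` in the second complex. -/
noncomputable def mapBifunctorShortComplexMap (S : ShortComplex (CochainComplex C₁ ℤ))
    {L L' : CochainComplex C₂ ℤ} (f : L ⟶ L') :
    mapBifunctorShortComplex F S L ⟶ mapBifunctorShortComplex F S L' where
  τ₁ := mapBifunctorMap (𝟙 S.X₁) f F (.up ℤ)
  τ₂ := mapBifunctorMap (𝟙 S.X₂) f F (.up ℤ)
  τ₃ := mapBifunctorMap (𝟙 S.X₃) f F (.up ℤ)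
  comm₁₂ := (F.map₂CochainComplex.map S.f).naturality f
  comm₂₃ := (F.map₂CochainComplex.map S.g).naturality f

/-- The direct summands of the terms of `mapBifunctorShortComplex`. -/
noncomputable def toMapBifunctorShortComplexEval (S : ShortComplex (CochainComplex C₁ ℤ))
    (L : CochainComplex C₂ ℤ) (n p : ℤ) :
    (S.map (eval C₁ _ p)).map (F.flip.obj (L.X (n - p))) ⟶
      (mapBifunctorShortComplex F S L).map (eval D _ n) where
  τ₁ := (1 : ℤˣ) • ιMapBifunctor S.X₁ L F (.up ℤ) p (n - p) n (add_sub_cancel _ _)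
  τ₂ := (1 : ℤˣ) • ιMapBifunctor S.X₂ L F (.up ℤ) p (n - p) n (add_sub_cancel _ _)
  τ₃ := (1 : ℤˣ) • ιMapBifunctor S.X₃ L F (.up ℤ) p (n - p) n (add_sub_cancel _ _)
  comm₁₂ := by
    change (_ • _) ≫ (mapBifunctorMap S.f (𝟙 L) F (.up ℤ)).f n = (F.map (S.f.f p)).app _ ≫ (_ • _)
    simp
  comm₂₃ := by
    change (_ • _) ≫ (mapBifunctorMap S.g (𝟙 L) F (.up ℤ)).f n = (F.map (S.g.f p)).app _ ≫ (_ • _)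
    simp

/-- Each degree of `mapBifunctorShortComplex` is a coproduct. -/
noncomputable def isTermwiseCoproductEval (S : ShortComplex (CochainComplex C₁ ℤ))
    (L : CochainComplex C₂ ℤ) (n : ℤ) :
    ShortComplex.IsTermwiseCoproduct (toMapBifunctorShortComplexEval F S L n) where
  isColimit₁ := mapBifunctorIsColimit F S.X₁ L n _ _ _
  isColimit₂ := mapBifunctorIsColimit F S.X₂ L n _ _ _
  isColimit₃ := mapBifunctorIsColimit F S.X₃ L n _ _ _

variable [AB4OfSize.{0} D]
  [∀ Y, PreservesFiniteLimits (F.flip.obj Y)]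
  [∀ Y, PreservesFiniteColimits (F.flip.obj Y)]

lemma shortExact_mapBifunctorShortComplex {S : ShortComplex (CochainComplex C₁ ℤ)}
    (hS : S.ShortExact) (L : CochainComplex C₂ ℤ) : (mapBifunctorShortComplex F S L).ShortExact :=
  shortExact_of_degreewise_shortExact _ fun n ↦
    (isTermwiseCoproductEval F S L n).shortExact fun p ↦
      (hS.map_of_exact (eval C₁ _ p)).map_of_exact (F.flip.obj (L.X (n - p)))

variable [∀ X, PreservesFiniteLimits (F.obj X)] [∀ X, PreservesFiniteColimits (F.obj X)]

lemma quasiIso_mapBifunctorMap_id_left (K : CochainComplex C₁ ℤ) {L L' : CochainComplex C₂ ℤ}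
    (f : L ⟶ L') [QuasiIso f] : QuasiIso (mapBifunctorMap (𝟙 K) f F (.up ℤ)) :=
  HomologySequence.quasiIso_τ₂ (mapBifunctorShortComplexMap F K.cyclesShortComplex f)
    (shortExact_mapBifunctorShortComplex F K.cyclesShortComplex_shortExact L)
    (shortExact_mapBifunctorShortComplex F K.cyclesShortComplex_shortExact L')
    (quasiIso_mapBifunctorMap_of_d_eq_zero F _ (fun _ _ ↦ rfl) f)
    (quasiIso_mapBifunctorMap_of_d_eq_zero F _ K.cokernel_cyclesComplexι_d f)

lemma quasiIso_mapBifunctorMap_id_right {K K' : CochainComplex C₁ ℤ} (f : K ⟶ K') [QuasiIso f]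
    (L : CochainComplex C₂ ℤ) : QuasiIso (mapBifunctorMap f (𝟙 L) F (.up ℤ)) := by
  have (X : C₁) : PreservesFiniteLimits (F.flip.flip.obj X) :=
    inferInstanceAs (PreservesFiniteLimits (F.obj X))
  have (X : C₁) : PreservesFiniteColimits (F.flip.flip.obj X) :=
    inferInstanceAs (PreservesFiniteColimits (F.obj X))
  have := quasiIso_mapBifunctorMap_id_left F.flip L f
  exact (quasiIso_iff_of_arrow_mk_iso _ _ (Arrow.isoMk (mapBifunctorFlipIso K L F (.up ℤ))
    (mapBifunctorFlipIso K' L F (.up ℤ))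
    (mapBifunctorFlipIso_hom_naturality f (𝟙 L) F (.up ℤ)).symm)).1 this

end

end HomologicalComplex

/-- Let `A` be a cocomplete symmetric monoidal abelian category such
that the tensor product is exact separately in each variable, the tensor product
preserves all small colimits separately in each variable, and filtered colimits
in `A` are exact (AB5). Then for every `ℤ`-indexed cochain complex `K` in `A` and
every quasi-isomorphism `f : L ⟶ L'` of `ℤ`-indexed cochain complexes in `A`,
both `id_K ⊗ f : K ⊗ L ⟶ K ⊗ L'` and `f ⊗ id_K : L ⊗ K ⟶ L' ⊗ K` are
quasi-isomorphisms (tensor products of complexes being the Koszul-signed total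
complexes, `HomologicalComplex.tensorObj`/`tensorHom`). -/
theorem tensorHom_quasiIso
    {A : Type u} [Category.{v} A] [Abelian A] [MonoidalCategory A] [SymmetricCategory A]
    [HasColimits A]
    [(curriedTensor A).Additive] [∀ (X : A), ((curriedTensor A).obj X).Additive]
    [∀ (X : A), ((curriedTensor A).flip.obj X).Additive]
    [∀ (X : A), PreservesFiniteLimits ((curriedTensor A).obj X)]
    [∀ (X : A), PreservesFiniteColimits ((curriedTensor A).obj X)]
    [∀ (X : A), PreservesFiniteLimits ((curriedTensor A).flip.obj X)]
    [∀ (X : A), PreservesFiniteColimits ((curriedTensor A).flip.obj X)]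
    [∀ (X : A), PreservesColimits ((curriedTensor A).obj X)]
    [∀ (X : A), PreservesColimits ((curriedTensor A).flip.obj X)]
    [HasFilteredColimits A] [AB5 A]
    (K : CochainComplex A ℤ) {L L' : CochainComplex A ℤ}
    (f : L ⟶ L') (hf : QuasiIso f) :
    QuasiIso (HomologicalComplex.tensorHom (𝟙 K) f) ∧
      QuasiIso (HomologicalComplex.tensorHom f (𝟙 K)) := by
  have := Abelian.hasFiniteBiproducts (C := A)
  have : AB4 A := AB4.of_AB5 A
  have : AB4OfSize.{0} A := AB4OfSize_shrink.{0, v} A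
  exact ⟨HomologicalComplex.quasiIso_mapBifunctorMap_id_left (curriedTensor A) K f,
    HomologicalComplex.quasiIso_mapBifunctorMap_id_right (curriedTensor A) f K⟩
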